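/- The element R ∈ Q⊗Q is invertible, satisfies R·Δ(a) = Δ^op(a)·R for all a ∈ Q, and satisfies (ε⊗id)(R) = 1 = (id⊗ε)(R). Moreover its 00-component equals the standard R-matrix: R·(e0⊗e0) = (1/2)·Σ_{m,n∈{0,1}} (−1)^{mn} (K^m⊗K^n)·(1⊗1 + 2i·E⊗F)·(e0⊗e0). -/

import Mathlib

open TensorProduct

set_option maxHeartbeats 1000000
set_option synthInstance.maxHeartbeats 400000

noncomputable section

/-- Generators of the restricted quantum group `Q = \bar U_i sl(2)`. -/
inductive QGen : Type
  | E | F | K | Kinv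
deriving DecidableEq

/-- The free algebra on the generators. -/
abbrev FA : Type := FreeAlgebra ℂ QGen

def ιE : FA := FreeAlgebra.ι ℂ QGen.E
def ιF : FA := FreeAlgebra.ι ℂ QGen.F
def ιK : FA := FreeAlgebra.ι ℂ QGen.K
def ιKi : FA := FreeAlgebra.ι ℂ QGen.Kinv

/-- Defining relations of `\bar U_i sl(2)` (at `q = i`, i.e. `p = 2`). -/
inductive QRel : FA → FA → Prop
  | KKi : QRel (ιK * ιKi) 1
  | KiK : QRel (ιKi * ιK) 1
  | KEKi : QRel (ιK * ιE * ιKi) (-ιE)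
  | KFKi : QRel (ιK * ιF * ιKi) (-ιF)
  | EF : QRel (ιE * ιF - ιF * ιE) ((2 * Complex.I)⁻¹ • (ιK - ιKi))
  | Esq : QRel (ιE ^ 2) 0
  | Fsq : QRel (ιF ^ 2) 0
  | K4 : QRel (ιK ^ 4) 1

/-- The restricted quantum group `\bar U_i sl(2)`: the quotient of the free algebra
by the two-sided ideal generated by the defining relations. -/
abbrev Q : Type := RingQuot QRel

def gE : Q := RingQuot.mkAlgHom ℂ QRel ιE
def gF : Q := RingQuot.mkAlgHom ℂ QRel ιF
def gK : Q := RingQuot.mkAlgHom ℂ QRel ιK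
def gKi : Q := RingQuot.mkAlgHom ℂ QRel ιKi

section Gadgets

variable (k : Type) [Field k] (A : Type) [Ring A] [Algebra k A]

abbrev TP2 : Type := A ⊗[k] A
abbrev TP3 : Type := A ⊗[k] (A ⊗[k] A)
abbrev TP4 : Type := A ⊗[k] (A ⊗[k] (A ⊗[k] A))

/-- Multiplication `a ⊗ b ↦ a * b`. -/
def mulA : TP2 k A →ₗ[k] A := LinearMap.mul' k A

/-- Tensor flip `a ⊗ b ↦ b ⊗ a`. -/
def flipA : TP2 k A →ₗ[k] TP2 k A := (TensorProduct.comm k A A).toLinearMap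

/-- `a ↦ a ⊗ 1`. -/
def lTen : A →ₗ[k] TP2 k A := (TensorProduct.mk k A A).flip 1

/-- `a ↦ 1 ⊗ a`. -/
def rTen : A →ₗ[k] TP2 k A := TensorProduct.mk k A A 1

/-- `a ⊗ b ↦ a ⊗ b ⊗ 1`. -/
def emb12 : TP2 k A →ₗ[k] TP3 k A := TensorProduct.map LinearMap.id (lTen k A)

/-- `a ⊗ b ↦ a ⊗ 1 ⊗ b`. -/
def emb13 : TP2 k A →ₗ[k] TP3 k A := TensorProduct.map LinearMap.id (rTen k A)

/-- `a ⊗ b ↦ 1 ⊗ a ⊗ b`. -/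
def emb23 : TP2 k A →ₗ[k] TP3 k A := TensorProduct.mk k A (TP2 k A) 1

/-- `a ⊗ b ⊗ c ↦ a ⊗ c ⊗ b`. -/
def perm132 : TP3 k A →ₗ[k] TP3 k A := TensorProduct.map LinearMap.id (flipA k A)

/-- `a ⊗ b ⊗ c ↦ b ⊗ c ⊗ a`. -/
def perm231 : TP3 k A →ₗ[k] TP3 k A :=
  (TensorProduct.assoc k A A A).toLinearMap ∘ₗ (TensorProduct.comm k A (TP2 k A)).toLinearMap

/-- `a ⊗ b ⊗ c ↦ c ⊗ a ⊗ b`. -/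
def perm312 : TP3 k A →ₗ[k] TP3 k A :=
  (TensorProduct.comm k (TP2 k A) A).toLinearMap ∘ₗ (TensorProduct.assoc k A A A).symm.toLinearMap

/-- `a ⊗ b ⊗ c ↦ b ⊗ a ⊗ c`. -/
def perm213 : TP3 k A →ₗ[k] TP3 k A :=
  (TensorProduct.assoc k A A A).toLinearMap ∘ₗ
    (TensorProduct.map (flipA k A) LinearMap.id) ∘ₗ (TensorProduct.assoc k A A A).symm.toLinearMap

variable {k A}

/-- `(Δ ⊗ id)` on two tensor factors, landing in the triple tensor product. -/
def copL (D : A →ₐ[k] TP2 k A) : TP2 k A →ₗ[k] TP3 k A :=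
  (TensorProduct.assoc k A A A).toLinearMap ∘ₗ TensorProduct.map D.toLinearMap LinearMap.id

/-- `(id ⊗ Δ)` on two tensor factors. -/
def copR (D : A →ₐ[k] TP2 k A) : TP2 k A →ₗ[k] TP3 k A :=
  TensorProduct.map LinearMap.id D.toLinearMap

/-- `(ε ⊗ id) : A ⊗ A → A`. -/
def cuL (ce : A →ₐ[k] k) : TP2 k A →ₗ[k] A :=
  (TensorProduct.lid k A).toLinearMap ∘ₗ TensorProduct.map ce.toLinearMap LinearMap.id

/-- `(id ⊗ ε) : A ⊗ A → A`. -/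
def cuR (ce : A →ₐ[k] k) : TP2 k A →ₗ[k] A :=
  (TensorProduct.rid k A).toLinearMap ∘ₗ TensorProduct.map LinearMap.id ce.toLinearMap

/-- `(id ⊗ ε ⊗ id) : A ⊗ A ⊗ A → A ⊗ A`. -/
def cuMid (ce : A →ₐ[k] k) : TP3 k A →ₗ[k] TP2 k A :=
  TensorProduct.map LinearMap.id (cuL ce)

/-- `(Δ ⊗ id ⊗ id)`. -/
def cop4_1 (D : A →ₐ[k] TP2 k A) : TP3 k A →ₗ[k] TP4 k A :=
  (TensorProduct.assoc k A A (TP2 k A)).toLinearMap ∘ₗ TensorProduct.map D.toLinearMap LinearMap.id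

/-- `(id ⊗ Δ ⊗ id)`. -/
def cop4_2 (D : A →ₐ[k] TP2 k A) : TP3 k A →ₗ[k] TP4 k A :=
  TensorProduct.map LinearMap.id (copL D)

/-- `(id ⊗ id ⊗ Δ)`. -/
def cop4_3 (D : A →ₐ[k] TP2 k A) : TP3 k A →ₗ[k] TP4 k A :=
  TensorProduct.map LinearMap.id (copR D)

/-- `a ⊗ b ⊗ c ↦ a ⊗ b ⊗ c ⊗ 1`, i.e. `Φ ↦ Φ ⊗ 1`. -/
def pad4 : TP3 k A →ₗ[k] TP4 k A :=
  TensorProduct.map LinearMap.id (TensorProduct.map LinearMap.id (lTen k A))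

/-- `a ⊗ b ⊗ c ↦ f(a) * g(b) * h(c)`. -/
def tmap3 (f g h : A →ₗ[k] A) : TP3 k A →ₗ[k] A :=
  mulA k A ∘ₗ TensorProduct.map f (mulA k A ∘ₗ TensorProduct.map g h)

/-- `a ⊗ b ↦ S(a) * b`, used in the antipode axiom `m ∘ (S ⊗ id) ∘ Δ = 1·ε`. -/
def antipL (s : A →ₗ[k] A) : TP2 k A →ₗ[k] A := mulA k A ∘ₗ TensorProduct.map s LinearMap.id

/-- `a ⊗ b ↦ a * S(b)`. -/
def antipR (s : A →ₗ[k] A) : TP2 k A →ₗ[k] A := mulA k A ∘ₗ TensorProduct.map LinearMap.id s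

end Gadgets

/-- Central idempotent `e₀ = (1 + K²)/2`. -/
def e0 : Q := (2:ℂ)⁻¹ • (1 + gK ^ 2)

/-- Central idempotent `e₁ = (1 − K²)/2`. -/
def e1 : Q := (2:ℂ)⁻¹ • (1 - gK ^ 2)

/-- `f⁺ = −i F`. -/
def fp : Q := (-Complex.I) • gF

/-- `f⁻ = E K⁻¹`. -/
def fm : Q := gE * gKi

/-- The Casimir element `C = FE − (i/4)(K − K⁻¹)`. -/
def Cas : Q := gF * gE - (Complex.I / 4) • (gK - gKi)

def t2 (a b : Q) : TP2 ℂ Q := a ⊗ₜ[ℂ] b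

def t3 (a b c : Q) : TP3 ℂ Q := a ⊗ₜ[ℂ] (b ⊗ₜ[ℂ] c)

def eEF : Q := gE * gF
def eEK : Q := gE * gK
def eFK : Q := gF * gK
def eEFK : Q := gE * gF * gK

/-- `Φ^{010}` component of the coassociator. -/
def Phi010 : TP3 ℂ Q :=
  t3 1 1 1 - (1 + Complex.I) • t3 gE gK gF + (1 - Complex.I) • t3 eFK gK eEK
    + (2:ℂ) • t3 eEFK 1 eEFK

/-- `Φ^{101}` component of the coassociator. -/
def Phi101 : TP3 ℂ Q :=
  (Complex.I - 1) • t3 1 gF eEK + t3 1 gK 1 + (2:ℂ) • t3 1 eEF eEFK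
    - (1 + Complex.I) • t3 1 eEK gF - (1 + Complex.I) • t3 gE eFK 1
    + (2 * Complex.I) • t3 gE eEFK gF + (1 - Complex.I) • t3 eFK gE 1
    - (2 * Complex.I) • t3 eFK eEFK eEK - (2:ℂ) • t3 eEFK eEF 1

/-- `Φ^{111}` component of the coassociator. -/
def Phi111 (β : ℂ) : TP3 ℂ Q :=
  (Complex.I * β ^ 2) • (
    (1 + Complex.I) • t3 1 gF eEK - t3 1 gK 1 - (2:ℂ) • t3 1 eEF 1
      - (2 * Complex.I) • t3 1 eEF eEFK + (1 + Complex.I) • t3 1 eEK gF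
      - (1 + Complex.I) • t3 gE 1 gF + (1 + Complex.I) • t3 gE eFK 1
      + (2 * Complex.I) • t3 gE eFK eEFK + (2:ℂ) • t3 gE eEFK gF
      - (1 + Complex.I) • t3 eFK 1 eEK + (1 + Complex.I) • t3 eFK gE 1
      + (2 * Complex.I) • t3 eFK gE eEFK + (2:ℂ) • t3 eFK eEFK eEK
      + (2 * Complex.I) • t3 eEFK gF eEK + (2 * Complex.I) • t3 eEFK gK eEFK
      - (2 * Complex.I) • t3 eEFK eEF 1 + (2 * Complex.I) • t3 eEFK eEK gF
      + (4:ℂ) • t3 eEFK eEF eEFK)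

/-- The coassociator `Φ` of the quasi-Hopf algebra structure on `Q`. -/
def Phi (β : ℂ) : TP3 ℂ Q :=
  t3 e0 e0 e0 + t3 e1 e0 e0 + Phi010 * t3 e0 e1 e0 + t3 e0 e0 e1
    + t3 e1 e1 e0 + Phi101 * t3 e1 e0 e1 + t3 e0 e1 e1 + Phi111 β * t3 e1 e1 e1

def R00 : TP2 ℂ Q :=
  (2:ℂ)⁻¹ • ((t2 1 1 + t2 1 gK + t2 gK 1 - t2 gK gK) * (t2 1 1 + (2 * Complex.I) • t2 gE gF))

def R01 : TP2 ℂ Q :=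
  (2:ℂ)⁻¹ • ((t2 1 1 - Complex.I • t2 1 gK + t2 gK 1 + Complex.I • t2 gK gK) *
    (t2 1 1 + (1 - Complex.I) • t2 eFK eEK - (1 - Complex.I) • t2 gE gF
      + (1 + Complex.I) • t2 eEFK 1 + (2 * Complex.I) • t2 eEFK eEFK))

def R10 : TP2 ℂ Q :=
  (2:ℂ)⁻¹ • ((t2 1 1 + t2 1 gK - Complex.I • t2 gK 1 + Complex.I • t2 gK gK) *
    (t2 1 gK + (1 - Complex.I) • t2 eFK gE + (1 - Complex.I) • t2 gE eFK
      - (1 - Complex.I) • t2 1 eEF - (2 * Complex.I) • t2 eEFK eEF))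

def R11 (β : ℂ) : TP2 ℂ Q :=
  (β / 2) • ((t2 1 1 - Complex.I • t2 1 gK - Complex.I • t2 gK 1 + t2 gK gK) *
    ((-Complex.I) • t2 gK 1 + (2 * Complex.I) • t2 eEK gF + (1 - Complex.I) • t2 gK eEFK
      - (1 + Complex.I) • t2 eEF 1 - (2 * Complex.I) • t2 eEF eEFK))

/-- The universal R-matrix `R` of the quasi-triangular quasi-Hopf structure on `Q`. -/
def Rmat (β : ℂ) : TP2 ℂ Q :=
  R00 * t2 e0 e0 + R01 * t2 e0 e1 + R10 * t2 e1 e0 + R11 β * t2 e1 e1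

/-- The standard R-matrix `R_st` of the quotient `Q/(K²-1)`. -/
def Rst : TP2 ℂ Q :=
  (2:ℂ)⁻¹ • ∑ m ∈ Finset.range 2, ∑ n ∈ Finset.range 2,
    ((-1:ℂ) ^ (m * n)) • (t2 (gK ^ m) (gK ^ n) * (t2 1 1 + (2 * Complex.I) • t2 gE gF))

/-- The monodromy matrix `M = R₂₁ · R`. -/
def Mmat (β : ℂ) : TP2 ℂ Q := flipA ℂ Q (Rmat β) * Rmat β

/-- The ribbon element `v = (e₀ − iβ K e₁)(1 − 2 f⁺ f⁻)`. -/
def vRib (β : ℂ) : Q := (e0 - (Complex.I * β) • (gK * e1)) * (1 - (2:ℂ) • (fp * fm))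

/-- The coevaluation element `β = e₀ − 2iβ² C e₁`. -/
def bbEl (β : ℂ) : Q := e0 - (2 * Complex.I * β ^ 2) • (Cas * e1)

/-- `b ⊗ c ↦ S(b · bb · S(c))`, inner part of the Drinfeld element. -/
def uInner (S : Q →ₗ[ℂ] Q) (bb : Q) : TP2 ℂ Q →ₗ[ℂ] Q :=
  S ∘ₗ mulA ℂ Q ∘ₗ TensorProduct.map (LinearMap.mulRight ℂ bb) S

/-- `Φ' ⊗ Φ'' ⊗ Φ''' ↦ S(Φ'' · bb · S(Φ''')) ⊗ Φ'`. -/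
def uMap1 (S : Q →ₗ[ℂ] Q) (bb : Q) : TP3 ℂ Q →ₗ[ℂ] TP2 ℂ Q :=
  TensorProduct.map (uInner S bb) LinearMap.id ∘ₗ (TensorProduct.comm ℂ Q (TP2 ℂ Q)).toLinearMap

/-- `R' ⊗ R'' ↦ S(R'') · al · R'`. -/
def uMap2 (S : Q →ₗ[ℂ] Q) (al : Q) : TP2 ℂ Q →ₗ[ℂ] Q :=
  mulA ℂ Q ∘ₗ TensorProduct.map (LinearMap.mulRight ℂ al ∘ₗ S) LinearMap.id ∘ₗ
    (TensorProduct.comm ℂ Q Q).toLinearMap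

/-- `(x ⊗ a) ⊗ (R' ⊗ R'') ↦ x · (S(R'') · al · R') · a`. -/
def uBig (S : Q →ₗ[ℂ] Q) (al : Q) : TP2 ℂ Q ⊗[ℂ] TP2 ℂ Q →ₗ[ℂ] Q :=
  mulA ℂ Q ∘ₗ TensorProduct.map LinearMap.id (mulA ℂ Q ∘ₗ (TensorProduct.comm ℂ Q Q).toLinearMap)
    ∘ₗ (TensorProduct.assoc ℂ Q Q Q).toLinearMap ∘ₗ TensorProduct.map LinearMap.id (uMap2 S al)

/-- The Drinfeld element `u = Σ S(Φ''·b·S(Φ'''))·S(R'')·α·R'·Φ'` (with `α = 1`). -/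
def uDrin (β : ℂ) (S : Q →ₗ[ℂ] Q) : Q :=
  uBig S 1 (uMap1 S (bbEl β) (Phi β) ⊗ₜ[ℂ] Rmat β)

/-- The balancing element `g = b · S(α) · v⁻¹ · u` (with `α = 1`). -/
def balG (β : ℂ) (S : Q →ₗ[ℂ] Q) : Q :=
  bbEl β * S 1 * Ring.inverse (vRib β) * uDrin β S

/-- The cointegral `c = (β²/i)·E·F·(1 + K + K² + K³)`. -/
def cInt (β : ℂ) : Q := (β ^ 2 / Complex.I) • (gE * gF * (1 + gK + gK ^ 2 + gK ^ 3))

/-- The q-trace of a one-dimensional representation, with balancing element `K⁻¹`. -/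
def qTr1 (ρ : Q →ₐ[ℂ] ℂ) : Q →ₗ[ℂ] ℂ := ρ.toLinearMap ∘ₗ LinearMap.mulLeft ℂ gK

/-- The q-trace of a two-dimensional (matrix) representation, with balancing element `K⁻¹`. -/
def qTrM (ρ : Q →ₐ[ℂ] Matrix (Fin 2) (Fin 2) ℂ) : Q →ₗ[ℂ] ℂ :=
  Matrix.traceLinearMap (Fin 2) ℂ ℂ ∘ₗ ρ.toLinearMap ∘ₗ LinearMap.mulLeft ℂ gK

/-- The Drinfeld mapping `φ ↦ (φ ⊗ id)(M)`. -/
def drinfeldImg (β : ℂ) (φ : Q →ₗ[ℂ] ℂ) : Q :=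
  (TensorProduct.lid ℂ Q) (TensorProduct.map φ LinearMap.id (Mmat β))

set_option linter.unusedSimpArgs false

/-! ## Computation in the corners of the algebra -/

/-- Relations of (a copy of) the quantum group in a corner cut out by a central idempotent `u`
on which `K² = s` and `[E,F] = t K`. -/
structure Corner {A : Type} [Ring A] [Algebra ℂ A] (s t : ℂ) (u E F K : A) : Prop where
  uu : u * u = u
  uE : u * E = E
  Eu : E * u = E
  uF : u * F = F
  Fu : F * u = F
  uK : u * K = K
  Ku : K * u = K
  KE : K * E = -(E * K)
  KF : K * F = -(F * K)
  KK : K * K = s • u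
  EE : E * E = 0
  FF : F * F = 0
  FE : F * E = E * F - t • K

namespace Corner

variable {A : Type} [Ring A] [Algebra ℂ A] {s t : ℂ} {u E F K : A}

theorem uu' (h : Corner s t u E F K) (x : A) : u * (u * x) = u * x := by
  rw [← mul_assoc, h.uu]
theorem uE' (h : Corner s t u E F K) (x : A) : u * (E * x) = E * x := by
  rw [← mul_assoc, h.uE]
theorem Eu' (h : Corner s t u E F K) (x : A) : E * (u * x) = E * x := by
  rw [← mul_assoc, h.Eu]
theorem uF' (h : Corner s t u E F K) (x : A) : u * (F * x) = F * x := by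
  rw [← mul_assoc, h.uF]
theorem Fu' (h : Corner s t u E F K) (x : A) : F * (u * x) = F * x := by
  rw [← mul_assoc, h.Fu]
theorem uK' (h : Corner s t u E F K) (x : A) : u * (K * x) = K * x := by
  rw [← mul_assoc, h.uK]
theorem Ku' (h : Corner s t u E F K) (x : A) : K * (u * x) = K * x := by
  rw [← mul_assoc, h.Ku]
theorem KE' (h : Corner s t u E F K) (x : A) : K * (E * x) = -(E * (K * x)) := by
  rw [← mul_assoc, h.KE, neg_mul, mul_assoc]
theorem KF' (h : Corner s t u E F K) (x : A) : K * (F * x) = -(F * (K * x)) := by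
  rw [← mul_assoc, h.KF, neg_mul, mul_assoc]
theorem KK' (h : Corner s t u E F K) (x : A) : K * (K * x) = s • (u * x) := by
  rw [← mul_assoc, h.KK, smul_mul_assoc]
theorem EE' (h : Corner s t u E F K) (x : A) : E * (E * x) = 0 := by
  rw [← mul_assoc, h.EE, zero_mul]
theorem FF' (h : Corner s t u E F K) (x : A) : F * (F * x) = 0 := by
  rw [← mul_assoc, h.FF, zero_mul]
theorem FE' (h : Corner s t u E F K) (x : A) : F * (E * x) = E * (F * x) - t • (K * x) := by
  rw [← mul_assoc, h.FE, sub_mul, smul_mul_assoc, mul_assoc]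

end Corner

/-- Everything that has to be computed in one of the four blocks: `P` is the unit of the block,
`R = D X` up to a scalar, `Y` is the inverse of `X`, and `a` is intertwined with `b`
for the three generators. -/
structure Block {T : Type} [Ring T] [Algebra ℂ T] (P D X Y aE bE aF bF aK bK : T) : Prop where
  PD : P * D = D
  DP : D * P = D
  PX : P * X = X
  XP : X * P = X
  PY : P * Y = Y
  YP : Y * P = Y
  DD : D * D = (4:ℂ) • P
  XY : X * Y = P
  YX : Y * X = P
  iE : D * X * aE = bE * (D * X)
  iF : D * X * aF = bF * (D * X)
  iK : D * X * aK = bK * (D * X)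

/-- The computation in block (0,0). -/
theorem block00 {A : Type} [Ring A] [Algebra ℂ A] {u E F K v E' F' K' : A}
    (h : Corner 1 0 u E F K) (k : Corner 1 0 v E' F' K') :
    Block (u ⊗ₜ[ℂ] v)
      ((u ⊗ₜ[ℂ] v) + (u ⊗ₜ[ℂ] K') + (K ⊗ₜ[ℂ] v) + (-1:ℂ) • (K ⊗ₜ[ℂ] K'))
      ((u ⊗ₜ[ℂ] v) +
        (2 * Complex.I) • (E ⊗ₜ[ℂ] F'))
      ((u ⊗ₜ[ℂ] v) +
        (-2 * Complex.I) • (E ⊗ₜ[ℂ] F'))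
      (u ⊗ₜ[ℂ] E' + E ⊗ₜ[ℂ] K') (E ⊗ₜ[ℂ] v + K ⊗ₜ[ℂ] E')
      ((K ⊗ₜ[ℂ] F') + F ⊗ₜ[ℂ] v) ((F ⊗ₜ[ℂ] K') + u ⊗ₜ[ℂ] F')
      (K ⊗ₜ[ℂ] K') (K ⊗ₜ[ℂ] K') := by
  have hI : Complex.I ^ 2 = -1 := Complex.I_sq
  constructor <;>
  simp only [mul_add, add_mul, mul_sub, sub_mul, smul_mul_assoc, mul_smul_comm,
    Algebra.TensorProduct.tmul_mul_tmul, mul_assoc, neg_mul, mul_neg, mul_zero, smul_zero,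
    TensorProduct.tmul_smul, ← TensorProduct.smul_tmul', TensorProduct.tmul_neg,
    TensorProduct.neg_tmul, TensorProduct.tmul_zero, TensorProduct.zero_tmul,
    TensorProduct.tmul_sub, TensorProduct.sub_tmul,
    h.uu, h.uE, h.Eu, h.uF, h.Fu, h.uK, h.Ku, h.KE, h.KF, h.KK, h.EE, h.FF, h.FE,
    h.uu', h.uE', h.Eu', h.uF', h.Fu', h.uK', h.Ku', h.KE', h.KF', h.KK', h.EE', h.FF', h.FE',
    k.uu, k.uE, k.Eu, k.uF, k.Fu, k.uK, k.Ku, k.KE, k.KF, k.KK, k.EE, k.FF, k.FE,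
    k.uu', k.uE', k.Eu', k.uF', k.Fu', k.uK', k.Ku', k.KE', k.KF', k.KK', k.EE', k.FF', k.FE'] <;>
  match_scalars <;> grind

/-- The computation in block (0,1). -/
theorem block01 {A : Type} [Ring A] [Algebra ℂ A] {u E F K v E' F' K' : A}
    (h : Corner 1 0 u E F K) (k : Corner (-1) (-Complex.I) v E' F' K') :
    Block (u ⊗ₜ[ℂ] v)
      ((u ⊗ₜ[ℂ] v) + (-1 * Complex.I) • (u ⊗ₜ[ℂ] K') + (K ⊗ₜ[ℂ] v) + (1 * Complex.I) • (K ⊗ₜ[ℂ] K'))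
      ((u ⊗ₜ[ℂ] v) +
        ((1:ℂ) + (-1) * Complex.I) • ((F * K) ⊗ₜ[ℂ] (E' * K')) +
        ((-1:ℂ) + (1) * Complex.I) • (E ⊗ₜ[ℂ] F') +
        ((1:ℂ) + (1) * Complex.I) • ((E * (F * K)) ⊗ₜ[ℂ] v) +
        (2 * Complex.I) • ((E * (F * K)) ⊗ₜ[ℂ] (E' * (F' * K'))))
      ((u ⊗ₜ[ℂ] v) +
        ((-1:ℂ) + (1) * Complex.I) • ((F * K) ⊗ₜ[ℂ] (E' * K')) +
        ((1:ℂ) + (-1) * Complex.I) • (E ⊗ₜ[ℂ] F') +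
        ((1:ℂ) + (-1) * Complex.I) • ((E * (F * K)) ⊗ₜ[ℂ] v) +
        (2 * Complex.I) • ((E * (F * K)) ⊗ₜ[ℂ] (E' * (F' * K'))))
      (u ⊗ₜ[ℂ] E' + E ⊗ₜ[ℂ] K') (E ⊗ₜ[ℂ] v + K ⊗ₜ[ℂ] E')
      ((K ⊗ₜ[ℂ] F') + F ⊗ₜ[ℂ] v) ((-1:ℂ) • (F ⊗ₜ[ℂ] K') + u ⊗ₜ[ℂ] F')
      (K ⊗ₜ[ℂ] K') (K ⊗ₜ[ℂ] K') := by
  have hI : Complex.I ^ 2 = -1 := Complex.I_sq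
  constructor <;>
  simp only [mul_add, add_mul, mul_sub, sub_mul, smul_mul_assoc, mul_smul_comm,
    Algebra.TensorProduct.tmul_mul_tmul, mul_assoc, neg_mul, mul_neg, mul_zero, smul_zero,
    TensorProduct.tmul_smul, ← TensorProduct.smul_tmul', TensorProduct.tmul_neg,
    TensorProduct.neg_tmul, TensorProduct.tmul_zero, TensorProduct.zero_tmul,
    TensorProduct.tmul_sub, TensorProduct.sub_tmul,
    h.uu, h.uE, h.Eu, h.uF, h.Fu, h.uK, h.Ku, h.KE, h.KF, h.KK, h.EE, h.FF, h.FE,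
    h.uu', h.uE', h.Eu', h.uF', h.Fu', h.uK', h.Ku', h.KE', h.KF', h.KK', h.EE', h.FF', h.FE',
    k.uu, k.uE, k.Eu, k.uF, k.Fu, k.uK, k.Ku, k.KE, k.KF, k.KK, k.EE, k.FF, k.FE,
    k.uu', k.uE', k.Eu', k.uF', k.Fu', k.uK', k.Ku', k.KE', k.KF', k.KK', k.EE', k.FF', k.FE'] <;>
  match_scalars <;> grind

/-- The computation in block (1,0). -/
theorem block10 {A : Type} [Ring A] [Algebra ℂ A] {u E F K v E' F' K' : A}
    (h : Corner (-1) (-Complex.I) u E F K) (k : Corner 1 0 v E' F' K') :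
    Block (u ⊗ₜ[ℂ] v)
      ((u ⊗ₜ[ℂ] v) + (u ⊗ₜ[ℂ] K') + (-1 * Complex.I) • (K ⊗ₜ[ℂ] v) + (1 * Complex.I) • (K ⊗ₜ[ℂ] K'))
      ((u ⊗ₜ[ℂ] K') +
        ((1:ℂ) + (-1) * Complex.I) • ((F * K) ⊗ₜ[ℂ] E') +
        ((1:ℂ) + (-1) * Complex.I) • (E ⊗ₜ[ℂ] (F' * K')) +
        ((-1:ℂ) + (1) * Complex.I) • (u ⊗ₜ[ℂ] (E' * F')) +
        (-2 * Complex.I) • ((E * (F * K)) ⊗ₜ[ℂ] (E' * F')))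
      ((u ⊗ₜ[ℂ] K') +
        ((-1:ℂ) + (-1) * Complex.I) • (u ⊗ₜ[ℂ] (E' * F')) +
        ((1:ℂ) + (-1) * Complex.I) • ((F * K) ⊗ₜ[ℂ] E') +
        ((1:ℂ) + (-1) * Complex.I) • (E ⊗ₜ[ℂ] (F' * K')) +
        (-2 * Complex.I) • ((E * (F * K)) ⊗ₜ[ℂ] (E' * F')))
      (u ⊗ₜ[ℂ] E' + E ⊗ₜ[ℂ] K') (E ⊗ₜ[ℂ] v + K ⊗ₜ[ℂ] E')
      ((-1:ℂ) • (K ⊗ₜ[ℂ] F') + F ⊗ₜ[ℂ] v) ((F ⊗ₜ[ℂ] K') + u ⊗ₜ[ℂ] F')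
      (K ⊗ₜ[ℂ] K') (K ⊗ₜ[ℂ] K') := by
  have hI : Complex.I ^ 2 = -1 := Complex.I_sq
  constructor <;>
  simp only [mul_add, add_mul, mul_sub, sub_mul, smul_mul_assoc, mul_smul_comm,
    Algebra.TensorProduct.tmul_mul_tmul, mul_assoc, neg_mul, mul_neg, mul_zero, smul_zero,
    TensorProduct.tmul_smul, ← TensorProduct.smul_tmul', TensorProduct.tmul_neg,
    TensorProduct.neg_tmul, TensorProduct.tmul_zero, TensorProduct.zero_tmul,
    TensorProduct.tmul_sub, TensorProduct.sub_tmul,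
    h.uu, h.uE, h.Eu, h.uF, h.Fu, h.uK, h.Ku, h.KE, h.KF, h.KK, h.EE, h.FF, h.FE,
    h.uu', h.uE', h.Eu', h.uF', h.Fu', h.uK', h.Ku', h.KE', h.KF', h.KK', h.EE', h.FF', h.FE',
    k.uu, k.uE, k.Eu, k.uF, k.Fu, k.uK, k.Ku, k.KE, k.KF, k.KK, k.EE, k.FF, k.FE,
    k.uu', k.uE', k.Eu', k.uF', k.Fu', k.uK', k.Ku', k.KE', k.KF', k.KK', k.EE', k.FF', k.FE'] <;>
  match_scalars <;> grind

/-- The computation in block (1,1). -/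
theorem block11 {A : Type} [Ring A] [Algebra ℂ A] {u E F K v E' F' K' : A}
    (h : Corner (-1) (-Complex.I) u E F K) (k : Corner (-1) (-Complex.I) v E' F' K') :
    Block (u ⊗ₜ[ℂ] v)
      ((u ⊗ₜ[ℂ] v) + (-1 * Complex.I) • (u ⊗ₜ[ℂ] K') + (-1 * Complex.I) • (K ⊗ₜ[ℂ] v) + (K ⊗ₜ[ℂ] K'))
      ((-1 * Complex.I) • (K ⊗ₜ[ℂ] v) +
        (2 * Complex.I) • ((E * K) ⊗ₜ[ℂ] F') +
        ((1:ℂ) + (-1) * Complex.I) • (K ⊗ₜ[ℂ] (E' * (F' * K'))) +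
        ((-1:ℂ) + (-1) * Complex.I) • ((E * F) ⊗ₜ[ℂ] v) +
        (-2 * Complex.I) • ((E * F) ⊗ₜ[ℂ] (E' * (F' * K'))))
      ((-1 * Complex.I) • (K ⊗ₜ[ℂ] v) +
        ((1:ℂ) + (1) * Complex.I) • (K ⊗ₜ[ℂ] (E' * (F' * K'))) +
        (2 * Complex.I) • ((E * K) ⊗ₜ[ℂ] F') +
        ((-1:ℂ) + (1) * Complex.I) • ((E * F) ⊗ₜ[ℂ] v) +
        (-2 * Complex.I) • ((E * F) ⊗ₜ[ℂ] (E' * (F' * K'))))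
      (u ⊗ₜ[ℂ] E' + E ⊗ₜ[ℂ] K') (E ⊗ₜ[ℂ] v + K ⊗ₜ[ℂ] E')
      ((-1:ℂ) • (K ⊗ₜ[ℂ] F') + F ⊗ₜ[ℂ] v) ((-1:ℂ) • (F ⊗ₜ[ℂ] K') + u ⊗ₜ[ℂ] F')
      (K ⊗ₜ[ℂ] K') (K ⊗ₜ[ℂ] K') := by
  have hI : Complex.I ^ 2 = -1 := Complex.I_sq
  constructor <;>
  simp only [mul_add, add_mul, mul_sub, sub_mul, smul_mul_assoc, mul_smul_comm,
    Algebra.TensorProduct.tmul_mul_tmul, mul_assoc, neg_mul, mul_neg, mul_zero, smul_zero,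
    TensorProduct.tmul_smul, ← TensorProduct.smul_tmul', TensorProduct.tmul_neg,
    TensorProduct.neg_tmul, TensorProduct.tmul_zero, TensorProduct.zero_tmul,
    TensorProduct.tmul_sub, TensorProduct.sub_tmul,
    h.uu, h.uE, h.Eu, h.uF, h.Fu, h.uK, h.Ku, h.KE, h.KF, h.KK, h.EE, h.FF, h.FE,
    h.uu', h.uE', h.Eu', h.uF', h.Fu', h.uK', h.Ku', h.KE', h.KF', h.KK', h.EE', h.FF', h.FE',
    k.uu, k.uE, k.Eu, k.uF, k.Fu, k.uK, k.Ku, k.KE, k.KF, k.KK, k.EE, k.FF, k.FE,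
    k.uu', k.uE', k.Eu', k.uF', k.Fu', k.uK', k.Ku', k.KE', k.KF', k.KK', k.EE', k.FF', k.FE'] <;>
  match_scalars <;> grind

/-! ## Relations in `Q` -/

theorem anti_of_conj {A : Type} [Ring A] {k e ki : A} (h : k * e * ki = -e) (h' : ki * k = 1) :
    k * e = -(e * k) := by
  calc k * e = k * e * (ki * k) := by rw [h', mul_one]
    _ = (k * e * ki) * k := by simp only [mul_assoc]
    _ = _ := by rw [h, neg_mul]

theorem comm_sq_of_anti {A : Type} [Ring A] {k e : A} (h : k * e = -(e * k)) :
    e * k ^ 2 = k ^ 2 * e := by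
  rw [pow_two, mul_assoc, h, mul_neg, ← mul_assoc k, h, neg_mul, neg_neg, mul_assoc]

theorem anti_cut {A : Type} [Ring A] {k e c : A} (h : k * e = -(e * k)) :
    k * e * c = -(e * k * c) := by
  rw [h, neg_mul]

theorem rKKi : gK * gKi = 1 := by
  have h := RingQuot.mkAlgHom_rel ℂ QRel.KKi
  simp only [map_mul, map_one] at h
  exact h

theorem rKiK : gKi * gK = 1 := by
  have h := RingQuot.mkAlgHom_rel ℂ QRel.KiK
  simp only [map_mul, map_one] at h
  exact h

theorem rKE : gK * gE = -(gE * gK) := by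
  have h := RingQuot.mkAlgHom_rel ℂ QRel.KEKi
  simp only [map_mul, map_neg] at h
  exact anti_of_conj h rKiK

theorem rKF : gK * gF = -(gF * gK) := by
  have h := RingQuot.mkAlgHom_rel ℂ QRel.KFKi
  simp only [map_mul, map_neg] at h
  exact anti_of_conj h rKiK

theorem rEE : gE * gE = 0 := by
  have h := RingQuot.mkAlgHom_rel ℂ QRel.Esq
  simp only [map_pow, map_zero, pow_two, map_mul] at h
  exact h

theorem rFF : gF * gF = 0 := by
  have h := RingQuot.mkAlgHom_rel ℂ QRel.Fsq
  simp only [map_pow, map_zero, pow_two, map_mul] at h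
  exact h

theorem rK4 : gK ^ 4 = 1 := by
  have h := RingQuot.mkAlgHom_rel ℂ QRel.K4
  simp only [map_pow, map_one] at h
  exact h

theorem rEF : gE * gF - gF * gE = (2 * Complex.I)⁻¹ • (gK - gKi) := by
  have h := RingQuot.mkAlgHom_rel ℂ QRel.EF
  simp only [map_mul, map_sub, map_smul] at h
  exact h

theorem rKi : gKi = gK * (gK * gK) := by
  calc gKi = gKi * gK ^ 4 := by rw [rK4, mul_one]
    _ = (gKi * gK) * (gK * (gK * gK)) := by simp only [pow_succ, pow_zero, one_mul, mul_assoc]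
    _ = _ := by rw [rKiK, one_mul]

/-- Induction principle: `Q` is generated by `E`, `F`, `K`. -/
theorem qInd (p : Q → Prop) (hs : ∀ c : ℂ, p (algebraMap ℂ Q c)) (hE : p gE) (hF : p gF)
    (hK : p gK) (hm : ∀ a b, p a → p b → p (a * b)) (ha : ∀ a b, p a → p b → p (a + b))
    (a : Q) : p a := by
  obtain ⟨x, rfl⟩ := RingQuot.mkAlgHom_surjective ℂ QRel a
  induction x using FreeAlgebra.induction with
  | grade0 c => rw [AlgHom.commutes]; exact hs c
  | grade1 g =>
    cases g
    · exact hE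
    · exact hF
    · exact hK
    · change p gKi
      rw [rKi]
      exact hm _ _ hK (hm _ _ hK hK)
  | mul x y hx hy => rw [map_mul]; exact hm _ _ hx hy
  | add x y hx hy => rw [map_add]; exact ha _ _ hx hy

theorem central_of_gen (e : Q) (hE : gE * e = e * gE) (hF : gF * e = e * gF)
    (hK : gK * e = e * gK) (x : Q) : x * e = e * x := by
  refine qInd (fun x => x * e = e * x) (fun c => Algebra.commutes c e) hE hF hK ?_ ?_ x
  · intro a b ha hb
    rw [mul_assoc, hb, ← mul_assoc, ha, mul_assoc]
  · intro a b ha hb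
    rw [add_mul, ha, hb, mul_add]

theorem K2_central (x : Q) : x * gK ^ 2 = gK ^ 2 * x := by
  apply central_of_gen
  · exact comm_sq_of_anti rKE
  · exact comm_sq_of_anti rKF
  · rw [pow_two, mul_assoc]

theorem K2K2 : gK ^ 2 * gK ^ 2 = 1 := by rw [← pow_add]; exact rK4

theorem e0_central (x : Q) : x * e0 = e0 * x := by
  simp only [e0, mul_smul_comm, smul_mul_assoc, mul_add, add_mul, mul_one, one_mul, K2_central]

theorem e1_central (x : Q) : x * e1 = e1 * x := by
  simp only [e1, mul_smul_comm, smul_mul_assoc, mul_sub, sub_mul, mul_one, one_mul, K2_central]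

theorem e0e0 : e0 * e0 = e0 := by
  simp only [e0, mul_smul_comm, smul_mul_assoc, mul_add, add_mul, mul_one, one_mul, K2K2]
  module

theorem e1e1 : e1 * e1 = e1 := by
  simp only [e1, mul_smul_comm, smul_mul_assoc, mul_sub, sub_mul, mul_one, one_mul, K2K2]
  module

theorem e0e1 : e0 * e1 = 0 := by
  simp only [e0, e1, mul_smul_comm, smul_mul_assoc, mul_sub, add_mul, mul_one, one_mul, K2K2]
  module

theorem e1e0 : e1 * e0 = 0 := by rw [e0_central, e0e1]

theorem e0_add_e1 : e0 + e1 = 1 := by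
  simp only [e0, e1]
  module

theorem KKe0 : gK * gK * e0 = (1:ℂ) • e0 := by
  rw [← pow_two]
  simp only [e0, mul_smul_comm, mul_add, mul_one, K2K2]
  module

theorem KKe1 : gK * gK * e1 = (-1:ℂ) • e1 := by
  rw [← pow_two]
  simp only [e1, mul_smul_comm, mul_sub, mul_one, K2K2]
  module

theorem cut (e : Q) (he : e * e = e) (hc : ∀ x, x * e = e * x) (x y : Q) :
    x * e * (y * e) = x * y * e := by
  rw [mul_assoc, ← mul_assoc e, ← hc y, mul_assoc, he, mul_assoc]

theorem Kie (s : ℂ) (e : Q) (hK : gK * gK * e = s • e) : gKi * e = s • (gK * e) := by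
  rw [rKi, mul_assoc, hK, mul_smul_comm]

theorem mkCorner (s t : ℂ) (ht : t = (2 * Complex.I)⁻¹ * (1 - s)) (e : Q) (he : e * e = e)
    (hc : ∀ x, x * e = e * x) (hK : gK * gK * e = s • e) :
    Corner s t e (gE * e) (gF * e) (gK * e) where
  uu := he
  uE := by rw [← hc, mul_assoc, he]
  Eu := by rw [mul_assoc, he]
  uF := by rw [← hc, mul_assoc, he]
  Fu := by rw [mul_assoc, he]
  uK := by rw [← hc, mul_assoc, he]
  Ku := by rw [mul_assoc, he]
  KE := by rw [cut e he hc, cut e he hc]; exact anti_cut rKE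
  KF := by rw [cut e he hc, cut e he hc]; exact anti_cut rKF
  KK := by rw [cut e he hc, hK]
  EE := by rw [cut e he hc, rEE, zero_mul]
  FF := by rw [cut e he hc, rFF, zero_mul]
  FE := by
    have h : gF * gE = gE * gF - (2 * Complex.I)⁻¹ • (gK - gKi) := by rw [← rEF]; abel
    rw [cut e he hc, cut e he hc, h, sub_mul, smul_mul_assoc, sub_mul, Kie s e hK, ht]
    module

theorem corner0 : Corner 1 0 e0 (gE * e0) (gF * e0) (gK * e0) :=
  mkCorner _ _ (by simp) e0 e0e0 e0_central KKe0

theorem corner1 : Corner (-1) (-Complex.I) e1 (gE * e1) (gF * e1) (gK * e1) :=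
  mkCorner _ _ (by rw [mul_inv, Complex.inv_I]; ring) e1 e1e1 e1_central KKe1

/-! ## Assembling the blocks -/

/-- What we need to know about one block `r` of the R-matrix. -/
structure Comp (P r : TP2 ℂ Q) : Prop where
  Pr : P * r = r
  rP : r * P = r
  inv : ∃ s, P * s = s ∧ s * P = s ∧ r * s = P ∧ s * r = P
  iE : r * (1 ⊗ₜ[ℂ] gE + gE ⊗ₜ[ℂ] gK) = (gE ⊗ₜ[ℂ] 1 + gK ⊗ₜ[ℂ] gE) * r
  iF : r * (gKi ⊗ₜ[ℂ] gF + gF ⊗ₜ[ℂ] 1) = (gF ⊗ₜ[ℂ] gKi + 1 ⊗ₜ[ℂ] gF) * r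
  iK : r * (gK ⊗ₜ[ℂ] gK) = (gK ⊗ₜ[ℂ] gK) * r

theorem Block.comp {P D X Y aE bE aF bF aK bK D' X' : TP2 ℂ Q}
    (B : Block P D X Y aE bE aF bF aK bK) (c : ℂ) (hc : c ≠ 0)
    (hD : D' * P = D) (hX : X' * P = X)
    (haE : P * (1 ⊗ₜ[ℂ] gE + gE ⊗ₜ[ℂ] gK) = aE)
    (hbE : (gE ⊗ₜ[ℂ] 1 + gK ⊗ₜ[ℂ] gE) * P = bE)
    (haF : P * (gKi ⊗ₜ[ℂ] gF + gF ⊗ₜ[ℂ] 1) = aF)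
    (hbF : (gF ⊗ₜ[ℂ] gKi + 1 ⊗ₜ[ℂ] gF) * P = bF)
    (haK : P * (gK ⊗ₜ[ℂ] gK) = aK) (hbK : (gK ⊗ₜ[ℂ] gK) * P = bK) :
    Comp P ((c • (D' * X')) * P) := by
  have hr : (c • (D' * X')) * P = c • (D * X) := by
    rw [smul_mul_assoc, mul_assoc, hX, ← B.PX, ← mul_assoc, hD, B.PX]
  have int : ∀ a b a' b' : TP2 ℂ Q, P * a = a' → b * P = b' → D * X * a' = b' * (D * X) →
      (c • (D * X)) * a = b * (c • (D * X)) := by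
    intro a b a' b' h1 h2 h3
    rw [smul_mul_assoc, mul_smul_comm]
    congr 1
    calc D * X * a = D * (X * P) * a := by rw [B.XP]
      _ = D * X * (P * a) := by simp only [mul_assoc]
      _ = b * P * (D * X) := by rw [h1, h3, h2]
      _ = b * (P * D * X) := by simp only [mul_assoc]
      _ = _ := by rw [B.PD]
  rw [hr]
  refine ⟨?_, ?_, ⟨(c⁻¹ * 4⁻¹) • (Y * D), ?_, ?_, ?_, ?_⟩, ?_, ?_, ?_⟩
  · rw [mul_smul_comm, ← mul_assoc, B.PD]
  · rw [smul_mul_assoc, mul_assoc, B.XP]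
  · rw [mul_smul_comm, ← mul_assoc, B.PY]
  · rw [smul_mul_assoc, mul_assoc, B.DP]
  · have h : D * X * (Y * D) = (4:ℂ) • P := by
      rw [mul_assoc, ← mul_assoc X, B.XY, B.PD, B.DD]
    rw [smul_mul_assoc, mul_smul_comm, h, smul_smul, smul_smul]
    rw [show c * (c⁻¹ * 4⁻¹) * 4 = 1 by field_simp, one_smul]
  · have h : Y * D * (D * X) = (4:ℂ) • P := by
      rw [mul_assoc, ← mul_assoc D, B.DD, smul_mul_assoc, B.PX, mul_smul_comm, B.YX]
    rw [smul_mul_assoc, mul_smul_comm, h, smul_smul, smul_smul]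
    rw [show c⁻¹ * 4⁻¹ * c * 4 = 1 by field_simp, one_smul]
  · exact int _ _ _ _ haE hbE B.iE
  · exact int _ _ _ _ haF hbF B.iF
  · exact int _ _ _ _ haK hbK B.iK

theorem comp00 : Comp (t2 e0 e0) (R00 * t2 e0 e0) := by
  unfold R00
  refine (block00 corner0 corner0).comp _ (inv_ne_zero two_ne_zero) ?_ ?_ ?_ ?_ ?_ ?_ ?_ ?_ <;>
    simp only [t2, eEF, eEK, eFK, eEFK, add_mul, sub_mul, mul_add, smul_mul_assoc, one_mul, mul_one,
      Algebra.TensorProduct.tmul_mul_tmul, ← e0_central, ← e1_central, Kie 1 e0 KKe0,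
      Kie (-1) e1 KKe1, one_smul, TensorProduct.tmul_smul, ← TensorProduct.smul_tmul',
      cut e0 e0e0 e0_central, cut e1 e1e1 e1_central, ← mul_assoc] <;>
    module

theorem comp01 : Comp (t2 e0 e1) (R01 * t2 e0 e1) := by
  unfold R01
  refine (block01 corner0 corner1).comp _ (inv_ne_zero two_ne_zero) ?_ ?_ ?_ ?_ ?_ ?_ ?_ ?_ <;>
    simp only [t2, eEF, eEK, eFK, eEFK, add_mul, sub_mul, mul_add, smul_mul_assoc, one_mul, mul_one,
      Algebra.TensorProduct.tmul_mul_tmul, ← e0_central, ← e1_central, Kie 1 e0 KKe0,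
      Kie (-1) e1 KKe1, one_smul, TensorProduct.tmul_smul, ← TensorProduct.smul_tmul',
      cut e0 e0e0 e0_central, cut e1 e1e1 e1_central, ← mul_assoc] <;>
    module

theorem comp10 : Comp (t2 e1 e0) (R10 * t2 e1 e0) := by
  unfold R10
  refine (block10 corner1 corner0).comp _ (inv_ne_zero two_ne_zero) ?_ ?_ ?_ ?_ ?_ ?_ ?_ ?_ <;>
    simp only [t2, eEF, eEK, eFK, eEFK, add_mul, sub_mul, mul_add, smul_mul_assoc, one_mul, mul_one,
      Algebra.TensorProduct.tmul_mul_tmul, ← e0_central, ← e1_central, Kie 1 e0 KKe0,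
      Kie (-1) e1 KKe1, one_smul, TensorProduct.tmul_smul, ← TensorProduct.smul_tmul',
      cut e0 e0e0 e0_central, cut e1 e1e1 e1_central, ← mul_assoc] <;>
    module

theorem comp11 (β : ℂ) (hβ : β ≠ 0) : Comp (t2 e1 e1) (R11 β * t2 e1 e1) := by
  unfold R11
  refine (block11 corner1 corner1).comp _ (div_ne_zero hβ two_ne_zero) ?_ ?_ ?_ ?_ ?_ ?_ ?_ ?_ <;>
    simp only [t2, eEF, eEK, eFK, eEFK, add_mul, sub_mul, mul_add, smul_mul_assoc, one_mul, mul_one,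
      Algebra.TensorProduct.tmul_mul_tmul, ← e0_central, ← e1_central, Kie 1 e0 KKe0,
      Kie (-1) e1 KKe1, one_smul, TensorProduct.tmul_smul, ← TensorProduct.smul_tmul',
      cut e0 e0e0 e0_central, cut e1 e1e1 e1_central, ← mul_assoc] <;>
    module

theorem unit_of_blocks {T ι : Type} [Ring T] [Fintype ι] [DecidableEq ι] (P r s : ι → T)
    (hP : ∑ i, P i = 1) (orth : ∀ i j, i ≠ j → P i * P j = 0)
    (h1 : ∀ i, P i * r i = r i) (h2 : ∀ i, r i * P i = r i)
    (h3 : ∀ i, P i * s i = s i) (h4 : ∀ i, s i * P i = s i)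
    (h5 : ∀ i, r i * s i = P i) (h6 : ∀ i, s i * r i = P i) : IsUnit (∑ i, r i) := by
  have key : ∀ a b : ι → T, (∀ i, a i * P i = a i) → (∀ i, P i * b i = b i) →
      (∀ i, a i * b i = P i) → (∑ i, a i) * (∑ i, b i) = 1 := by
    intro a b ha hb hab
    rw [Finset.sum_mul_sum, ← hP]
    refine Finset.sum_congr rfl fun i _ => ?_
    rw [Finset.sum_eq_single i, hab]
    · intro j _ hj
      rw [← ha, ← hb, mul_assoc, ← mul_assoc (P i), orth i j hj.symm, zero_mul, mul_zero]
    · intro h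
      exact absurd (Finset.mem_univ i) h
  exact ⟨⟨∑ i, r i, ∑ i, s i, key r s h2 h3 h5, key s r h4 h1 h6⟩, rfl⟩

/-- The index-free form for four blocks. -/
theorem isUnit_four {P₁ P₂ P₃ P₄ r₁ r₂ r₃ r₄ : TP2 ℂ Q} (hP : P₁ + P₂ + P₃ + P₄ = 1)
    (c₁ : Comp P₁ r₁) (c₂ : Comp P₂ r₂) (c₃ : Comp P₃ r₃) (c₄ : Comp P₄ r₄)
    (orth : ∀ i j : Fin 4, i ≠ j → ![P₁, P₂, P₃, P₄] i * ![P₁, P₂, P₃, P₄] j = 0) :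
    IsUnit (r₁ + r₂ + r₃ + r₄) := by
  have hc : ∀ i : Fin 4, Comp (![P₁, P₂, P₃, P₄] i) (![r₁, r₂, r₃, r₄] i) := by
    intro i
    fin_cases i
    exacts [c₁, c₂, c₃, c₄]
  choose s hs using fun i => (hc i).inv
  have := unit_of_blocks _ _ s (by rw [Fin.sum_univ_four]; exact hP) orth (fun i => (hc i).Pr)
    (fun i => (hc i).rP) (fun i => (hs i).1) (fun i => (hs i).2.1) (fun i => (hs i).2.2.1)
    (fun i => (hs i).2.2.2)
  rw [Fin.sum_univ_four] at this
  exact this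

theorem t2_mul (a b c d : Q) : t2 a b * t2 c d = t2 (a * c) (b * d) :=
  Algebra.TensorProduct.tmul_mul_tmul _ _ _ _

theorem sum_P : t2 e0 e0 + t2 e0 e1 + t2 e1 e0 + t2 e1 e1 = 1 := by
  have h : t2 (e0 + e1) (e0 + e1) = 1 := by
    rw [e0_add_e1]; rfl
  rw [← h]
  simp only [t2, TensorProduct.tmul_add, TensorProduct.add_tmul]
  abel

theorem Rmat_isUnit (β : ℂ) (hβ : β ≠ 0) : IsUnit (Rmat β) := by
  refine isUnit_four sum_P comp00 comp01 comp10 (comp11 β hβ) ?_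
  intro i j hij
  fin_cases i <;> fin_cases j <;> first | exact absurd rfl hij | skip
  all_goals
    simp only [Fin.zero_eta, Fin.mk_one, Fin.reduceFinMk, Matrix.cons_val]
    simp only [t2_mul, e0e1, e1e0]
    simp only [t2, TensorProduct.tmul_zero, TensorProduct.zero_tmul]

theorem flip_mul (x y : TP2 ℂ Q) : flipA ℂ Q (x * y) = flipA ℂ Q x * flipA ℂ Q y :=
  map_mul (Algebra.TensorProduct.comm ℂ Q Q) x y

theorem flip_tmul (x y : Q) : flipA ℂ Q (x ⊗ₜ[ℂ] y) = y ⊗ₜ[ℂ] x :=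
  TensorProduct.comm_tmul ℂ Q Q x y

theorem Rmat_intertwine (β : ℂ) (hβ : β ≠ 0) (Δ : Q →ₐ[ℂ] TP2 ℂ Q)
    (hΔE : Δ gE = (1:Q) ⊗ₜ[ℂ] gE + gE ⊗ₜ[ℂ] gK)
    (hΔF : Δ gF = gKi ⊗ₜ[ℂ] gF + gF ⊗ₜ[ℂ] (1:Q))
    (hΔK : Δ gK = gK ⊗ₜ[ℂ] gK) (a : Q) :
    Rmat β * Δ a = flipA ℂ Q (Δ a) * Rmat β := by
  refine qInd (fun a => Rmat β * Δ a = flipA ℂ Q (Δ a) * Rmat β) ?_ ?_ ?_ ?_ ?_ ?_ a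
  · intro c
    have h : flipA ℂ Q (algebraMap ℂ (TP2 ℂ Q) c) = algebraMap ℂ (TP2 ℂ Q) c :=
      (Algebra.TensorProduct.comm ℂ Q Q).commutes c
    rw [AlgHom.commutes, h]
    exact (Algebra.commutes c _).symm
  · rw [hΔE, map_add, flip_tmul, flip_tmul, Rmat]
    rw [add_mul (_ + _), add_mul (_ + _), add_mul (R00 * _), mul_add _ (_ + _), mul_add _ (_ + _),
      mul_add _ (R00 * _), comp00.iE, comp01.iE, comp10.iE, (comp11 β hβ).iE]
  · rw [hΔF, map_add, flip_tmul, flip_tmul, Rmat]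
    rw [add_mul (_ + _), add_mul (_ + _), add_mul (R00 * _), mul_add _ (_ + _), mul_add _ (_ + _),
      mul_add _ (R00 * _), comp00.iF, comp01.iF, comp10.iF, (comp11 β hβ).iF]
  · rw [hΔK, flip_tmul, Rmat]
    rw [add_mul (_ + _), add_mul (_ + _), add_mul (R00 * _), mul_add _ (_ + _), mul_add _ (_ + _),
      mul_add _ (R00 * _), comp00.iK, comp01.iK, comp10.iK, (comp11 β hβ).iK]
  · intro a b ha hb
    rw [map_mul, flip_mul, ← mul_assoc, ha, mul_assoc, hb, mul_assoc]
  · intro a b ha hb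
    rw [map_add, map_add, mul_add, add_mul, ha, hb]

theorem cuL_mul (ce : Q →ₐ[ℂ] ℂ) (x y : TP2 ℂ Q) : cuL ce (x * y) = cuL ce x * cuL ce y := by
  have h : ∀ z, cuL ce z = ((Algebra.TensorProduct.lid ℂ Q).toAlgHom.comp
      (Algebra.TensorProduct.map ce (AlgHom.id ℂ Q))) z := fun z => rfl
  rw [h, h, h, map_mul]

theorem cuR_mul (ce : Q →ₐ[ℂ] ℂ) (x y : TP2 ℂ Q) : cuR ce (x * y) = cuR ce x * cuR ce y := by
  have h : ∀ z, cuR ce z = ((Algebra.TensorProduct.rid ℂ ℂ Q).toAlgHom.comp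
      (Algebra.TensorProduct.map (AlgHom.id ℂ Q) ce)) z := fun z => rfl
  rw [h, h, h, map_mul]

theorem cuL_t2 (ce : Q →ₐ[ℂ] ℂ) (x y : Q) : cuL ce (t2 x y) = ce x • y := rfl

theorem cuR_t2 (ce : Q →ₐ[ℂ] ℂ) (x y : Q) : cuR ce (t2 x y) = ce y • x := rfl

theorem Rmat_cuL (β : ℂ) (ce : Q →ₐ[ℂ] ℂ) (hceE : ce gE = 0) (hceF : ce gF = 0)
    (hceK : ce gK = 1) : cuL ce (Rmat β) = 1 := by
  have h0 : ce e0 = 1 := by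
    rw [e0, map_smul, map_add, map_pow, map_one, hceK, smul_eq_mul]; norm_num
  have h1 : ce e1 = 0 := by
    rw [e1, map_smul, map_sub, map_pow, map_one, hceK, smul_eq_mul]; norm_num
  rw [← e0_add_e1]
  simp only [Rmat, R00, R01, map_add, map_sub, map_smul, cuL_mul, cuL_t2, h0, h1, eEF, eEK, eFK,
    eEFK, map_mul, hceE, hceF, hceK, map_one, one_smul, zero_smul, mul_zero, zero_mul, smul_zero,
    add_zero, sub_zero, mul_one]
  simp only [smul_mul_assoc, add_mul, sub_mul, one_mul]
  module

theorem Rmat_cuR (β : ℂ) (ce : Q →ₐ[ℂ] ℂ) (hceE : ce gE = 0) (hceF : ce gF = 0)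
    (hceK : ce gK = 1) : cuR ce (Rmat β) = 1 := by
  have h0 : ce e0 = 1 := by
    rw [e0, map_smul, map_add, map_pow, map_one, hceK, smul_eq_mul]; norm_num
  have h1 : ce e1 = 0 := by
    rw [e1, map_smul, map_sub, map_pow, map_one, hceK, smul_eq_mul]; norm_num
  rw [← e0_add_e1]
  simp only [Rmat, R00, R10, map_add, map_sub, map_smul, cuR_mul, cuR_t2, h0, h1, eEF, eEK, eFK,
    eEFK, map_mul, hceE, hceF, hceK, map_one, one_smul, zero_smul, mul_zero, zero_mul, smul_zero,
    add_zero, sub_zero, mul_one]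
  simp only [smul_mul_assoc, add_mul, sub_mul, one_mul]
  module

theorem Rmat_00 (β : ℂ) : Rmat β * t2 e0 e0 = Rst * t2 e0 e0 := by
  have h : Rmat β * t2 e0 e0 = R00 * t2 e0 e0 := by
    have z : ∀ x : Q, t2 x 0 = 0 := fun x => TensorProduct.tmul_zero _ _
    have z' : ∀ x : Q, t2 0 x = 0 := fun x => TensorProduct.zero_tmul _ _
    simp only [Rmat, add_mul, mul_assoc, t2_mul, e0e0, e0e1, e1e0, z, z', mul_zero, add_zero]
  rw [h]
  congr 1
  simp only [R00, Rst, Finset.sum_range_succ, Finset.sum_range_zero, zero_add, pow_zero, pow_one,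
    mul_zero, zero_mul, mul_one, one_smul, add_mul, sub_mul]
  module

/-- the R-matrix `R` is invertible, intertwines `Δ` and `Δ^op`, is
counital, and its `00`-component equals the standard R-matrix `R_st`. -/
theorem statement8 (β : ℂ) (hβ : β ^ 4 = -1)
    (Δ : Q →ₐ[ℂ] TP2 ℂ Q)
    (hΔE : Δ gE = (1:Q) ⊗ₜ[ℂ] gE + gE ⊗ₜ[ℂ] gK)
    (hΔF : Δ gF = gKi ⊗ₜ[ℂ] gF + gF ⊗ₜ[ℂ] (1:Q))
    (hΔK : Δ gK = gK ⊗ₜ[ℂ] gK)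
    (ce : Q →ₐ[ℂ] ℂ) (hceE : ce gE = 0) (hceF : ce gF = 0) (hceK : ce gK = 1) :
    IsUnit (Rmat β) ∧
    (∀ a : Q, Rmat β * Δ a = flipA ℂ Q (Δ a) * Rmat β) ∧
    cuL ce (Rmat β) = 1 ∧ cuR ce (Rmat β) = 1 ∧
    Rmat β * t2 e0 e0 = Rst * t2 e0 e0 := by
  have h0 : β ≠ 0 := by
    rintro rfl
    norm_num at hβ
  exact ⟨Rmat_isUnit β h0, Rmat_intertwine β h0 Δ hΔE hΔF hΔK, Rmat_cuL β ce hceE hceF hceK,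
    Rmat_cuR β ce hceE hceF hceK, Rmat_00 β⟩
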